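/- arXiv:2402.09905 — 5 statements merged into one kernel-verified Lean document; each statement's English description precedes it below -/
import Mathlib

section
/- Let P be a finite bounded graded poset. The family of characteristic polynomials of the intervals of P is a P-kernel; explicitly: (i) χ_{xx}(t) = 1 for every x ∈ P; (ii) deg χ_{xy} ≤ rk[x,y] for all x ≤ y in P; and (iii) for all x < z in P one has Σ_{x≤y≤z} χ̄_{xy}(t)·χ_{yz}(t) = 0 in ℤ[t]. -/
/-- A function satisfying the defining recursion of the Möbius function agrees with
`IncidenceAlgebra.mu` on comparable pairs. -/
theorem eq_mu_of_sum_Icc_eq_zero {P : Type*} [PartialOrder P] [LocallyFiniteOrder P]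
    [DecidableEq P] (μ : P → P → ℤ) (hμ_refl : ∀ x : P, μ x x = 1)
    (hμ_sum : ∀ x y : P, x < y → ∑ w ∈ Finset.Icc x y, μ x w = 0) {x y : P} (hxy : x ≤ y) :
    μ x y = IncidenceAlgebra.mu ℤ x y := by
  classical
  let f : IncidenceAlgebra ℤ P := ⟨fun a b => if a ≤ b then μ a b else 0, fun _ _ h => if_neg h⟩
  have hf : ∀ a b, a ≤ b → f a b = μ a b := fun a b h => if_pos h
  have hfz : f * IncidenceAlgebra.zeta ℤ = 1 := by
    ext a b hab
    rw [IncidenceAlgebra.mul_apply, IncidenceAlgebra.one_apply]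
    have h : ∑ w ∈ Finset.Icc a b, f a w * IncidenceAlgebra.zeta ℤ w b =
        ∑ w ∈ Finset.Icc a b, μ a w := by
      refine Finset.sum_congr rfl fun w hw => ?_
      rw [Finset.mem_Icc] at hw
      rw [hf a w hw.1, IncidenceAlgebra.zeta_of_le hw.2, mul_one]
    rw [h]
    split_ifs with hne
    · subst hne
      simp [hμ_refl]
    · exact hμ_sum a b (lt_of_le_of_ne hab hne)
  rw [← hf x y hxy, left_inv_eq_right_inv hfz IncidenceAlgebra.zeta_mul_mu]

/-- The left-handed recursion for the Möbius function. -/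
theorem sum_Icc_left_of_sum_Icc_eq_zero {P : Type*} [PartialOrder P] [LocallyFiniteOrder P]
    [DecidableEq P] (μ : P → P → ℤ) (hμ_refl : ∀ x : P, μ x x = 1)
    (hμ_sum : ∀ x y : P, x < y → ∑ w ∈ Finset.Icc x y, μ x w = 0) (x y : P) :
    ∑ w ∈ Finset.Icc x y, μ w y = if x = y then 1 else 0 := by
  rw [← IncidenceAlgebra.sum_Icc_mu_left]
  exact Finset.sum_congr rfl fun w hw =>
    eq_mu_of_sum_Icc_eq_zero μ hμ_refl hμ_sum (Finset.mem_Icc.1 hw).2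

/-- Let `P` be a finite bounded graded poset, with rank function `rk`
and Möbius function `μ`.  The family of characteristic polynomials
`χ_{xy}(t) = ∑_{x ≤ w ≤ y} μ(x,w) t^{rk[w,y]}` of the intervals of `P` is a `P`-kernel:
(i) `χ_{xx} = 1`; (ii) `deg χ_{xy} ≤ rk[x,y]`; (iii) for all `x < z`,
`∑_{x ≤ y ≤ z} χ̄_{xy}(t) χ_{yz}(t) = 0`, where
`χ̄_{xy}(t) = ∑_{x ≤ w ≤ y} μ(x,w) t^{rk[x,w]}`. -/
theorem characteristic_polynomials_form_P_kernel
    {P : Type*} [PartialOrder P] [BoundedOrder P] [Fintype P] [LocallyFiniteOrder P]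
    (rk : P → ℕ) (hrk_bot : rk ⊥ = 0)
    (hrk_cov : ∀ x y : P, x ⋖ y → rk y = rk x + 1)
    (μ : P → P → ℤ)
    (hμ_refl : ∀ x : P, μ x x = 1)
    (hμ_sum : ∀ x y : P, x < y → ∑ w ∈ Finset.Icc x y, μ x w = 0) :
    (∀ x : P,
      (∑ w ∈ Finset.Icc x x, Polynomial.C (μ x w) * Polynomial.X ^ (rk x - rk w)) = 1) ∧
    (∀ x y : P, x ≤ y →
      (∑ w ∈ Finset.Icc x y, Polynomial.C (μ x w) * Polynomial.X ^ (rk y - rk w)).natDegree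
        ≤ rk y - rk x) ∧
    (∀ x z : P, x < z →
      ∑ y ∈ Finset.Icc x z,
        (∑ w ∈ Finset.Icc x y, Polynomial.C (μ x w) * Polynomial.X ^ (rk w - rk x)) *
          (∑ w ∈ Finset.Icc y z, Polynomial.C (μ y w) * Polynomial.X ^ (rk z - rk w)) = 0) := by
  classical
  have hmono : Monotone rk :=
    (monotone_iff_forall_covBy rk).2 fun a b h => by rw [hrk_cov a b h]; exact Nat.le_succ _
  refine ⟨fun x => by simp [hμ_refl], fun x y _ => ?_, fun x z hxz => ?_⟩
  · refine Polynomial.natDegree_sum_le_of_forall_le _ _ fun w hw => ?_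
    exact (Polynomial.natDegree_C_mul_X_pow_le _ _).trans
      (Nat.sub_le_sub_left (hmono (Finset.mem_Icc.1 hw).1) _)
  · have hterm : ∀ y ∈ Finset.Icc x z,
        (∑ w ∈ Finset.Icc x y, Polynomial.C (μ x w) * Polynomial.X ^ (rk w - rk x)) *
          (∑ v ∈ Finset.Icc y z, Polynomial.C (μ y v) * Polynomial.X ^ (rk z - rk v)) =
        ∑ w ∈ Finset.Icc x y, ∑ v ∈ Finset.Icc y z,
          (Polynomial.C (μ x w) * Polynomial.X ^ (rk w - rk x)) *
            (Polynomial.C (μ y v) * Polynomial.X ^ (rk z - rk v)) :=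
      fun y _ => Finset.sum_mul_sum _ _ _ _
    have hinner : ∀ w ∈ Finset.Icc x z,
        ∑ y ∈ Finset.Icc w z, ∑ v ∈ Finset.Icc y z,
          (Polynomial.C (μ x w) * Polynomial.X ^ (rk w - rk x)) *
            (Polynomial.C (μ y v) * Polynomial.X ^ (rk z - rk v)) =
        Polynomial.C (μ x w) * Polynomial.X ^ (rk z - rk x) := by
      intro w hw
      rw [Finset.mem_Icc] at hw
      rw [Finset.sum_comm' (s' := fun v => Finset.Icc w v) (t' := Finset.Icc w z)]
      · simp_rw [← Finset.mul_sum, ← Finset.sum_mul, ← map_sum,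
          sum_Icc_left_of_sum_Icc_eq_zero μ hμ_refl hμ_sum]
        rw [Finset.sum_eq_single_of_mem w (Finset.left_mem_Icc.2 hw.2)
          fun v _ hv => by rw [if_neg hv.symm, map_zero, zero_mul]]
        rw [if_pos rfl, map_one, one_mul, mul_assoc, ← pow_add, add_comm,
          Nat.sub_add_sub_cancel (hmono hw.2) (hmono hw.1)]
      · intro y v
        simp only [Finset.mem_Icc]
        exact ⟨fun h => ⟨⟨h.1.1, h.2.1⟩, h.1.1.trans h.2.1, h.2.2⟩,
          fun h => ⟨⟨h.1.1, h.1.2.trans h.2.2⟩, h.1.2, h.2.2⟩⟩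
    rw [Finset.sum_congr rfl hterm,
      Finset.sum_comm' (s' := fun w => Finset.Icc w z) (t' := Finset.Icc x z)]
    · rw [Finset.sum_congr rfl hinner, ← Finset.sum_mul, ← map_sum, hμ_sum x z hxz, map_zero,
        zero_mul]
    · intro y w
      simp only [Finset.mem_Icc]
      exact ⟨fun h => ⟨⟨h.2.2, h.1.2⟩, h.2.1, h.2.2.trans h.1.2⟩,
        fun h => ⟨⟨h.2.1.trans h.1.1, h.1.2⟩, h.2.1, h.1.1⟩⟩
end

section
/- Let P be a finite bounded graded poset and let κ be a P-kernel. Then there exists a unique family f = (f_{xy})_{x≤y∈P} of polynomials in ℤ[t] (the right Kazhdan–Lusztig–Stanley polynomials of κ) such that: (i) f_{xx}(t) = 1 for all x ∈ P; (ii) deg f_{xy} < rk[x,y]/2 for all x < y; and (iii) for all x < z, t^{rk[x,z]}·f_{xz}(1/t) = Σ_{x≤y≤z} κ_{xy}(t)·f_{yz}(t) in ℤ[t]. -/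
open Polynomial in
theorem Polynomial.two_mul_degree_lt_iff {R : Type*} [Semiring R] (p : R[X]) (d : ℕ) :
    2 * p.degree < (d : WithBot ℕ) ↔ ∀ i, d ≤ 2 * i → p.coeff i = 0 := by
  by_cases hp : p = 0
  · subst hp
    have h : (2 : WithBot ℕ) * ⊥ = ⊥ := WithBot.mul_bot (by norm_num)
    simp [h]
  · rw [degree_eq_natDegree hp]
    have h : (2 : WithBot ℕ) * (p.natDegree : WithBot ℕ) < (d : WithBot ℕ) ↔
        2 * p.natDegree < d := by norm_cast
    rw [h]
    constructor
    · intro h i hi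
      exact coeff_eq_zero_of_natDegree_lt (by omega)
    · intro h
      by_contra hd
      exact hp (leadingCoeff_eq_zero.mp (h _ (by omega)))

open Polynomial in
/-- A polynomial of degree less than `d / 2` is determined by the difference between its
`d`-reversal and itself. -/
theorem Polynomial.eq_of_reflect_sub_eq {R : Type*} [Ring R] {d : ℕ} {p q : R[X]}
    (hp : ∀ i, d ≤ 2 * i → p.coeff i = 0) (hq : ∀ i, d ≤ 2 * i → q.coeff i = 0)
    (h : reflect d p - p = reflect d q - q) : p = q := by
  ext i
  by_cases hi : d ≤ 2 * i
  · rw [hp i hi, hq i hi]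
  · have := congrArg (fun r => coeff r i) h
    simp only [coeff_sub, coeff_reflect, revAt_le (show i ≤ d by omega)] at this
    rw [hp (d - i) (by omega), hq (d - i) (by omega)] at this
    simpa using this

open Polynomial in
/-- The negative of the part of `q` of degree less than `d / 2`. -/
noncomputable def Polynomial.negLowerHalf {R : Type*} [Ring R] (d : ℕ) (q : R[X]) : R[X] :=
  -∑ i ∈ Finset.range ((d + 1) / 2), monomial i (q.coeff i)

open Polynomial in
theorem Polynomial.coeff_negLowerHalf {R : Type*} [Ring R] (d : ℕ) (q : R[X]) (i : ℕ) :
    (negLowerHalf d q).coeff i = if 2 * i < d then -q.coeff i else 0 := by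
  have h : i < (d + 1) / 2 ↔ 2 * i < d := by omega
  simp only [negLowerHalf, coeff_neg, finsetSum_coeff, coeff_monomial, Finset.sum_ite_eq',
    Finset.mem_range, h]
  split_ifs <;> simp

open Polynomial in
/-- An antisymmetric polynomial is the difference of the reversal of `negLowerHalf` and itself. -/
theorem Polynomial.reflect_negLowerHalf {d : ℕ} {q : ℤ[X]} (hdeg : q.natDegree ≤ d)
    (hq : reflect d q = -q) : reflect d (negLowerHalf d q) = negLowerHalf d q + q := by
  ext i
  rw [coeff_add, coeff_reflect, coeff_negLowerHalf, coeff_negLowerHalf]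
  by_cases hi : i ≤ d
  · have := congrArg (fun r => coeff r i) hq
    simp only [coeff_neg, coeff_reflect, revAt_le hi] at this
    rw [revAt_le hi, this]
    rcases lt_trichotomy (2 * i) d with h | h | h
    · simp [h, show ¬ 2 * (d - i) < d by omega]
    · rw [show d - i = i by omega] at this
      simp [show ¬ 2 * i < d by omega, show ¬ 2 * (d - i) < d by omega]
      omega
    · simp [show ¬ 2 * i < d by omega, show 2 * (d - i) < d by omega]
  · rw [revAt_eq_self_of_lt (by omega), coeff_eq_zero_of_natDegree_lt (p := q) (by omega)]
    simp

theorem WellFoundedGT.exists_eq_of_restrict {P M : Type*} [Preorder P] [WellFoundedGT P] [Zero M]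
    [DecidableLT P] (Φ : P → (P → M) → M) :
    ∃ F : P → M, ∀ x, F x = Φ x (fun y => if x < y then F y else 0) := by
  let G : ∀ x : P, (∀ y, y > x → M) → M :=
    fun x h => Φ x (fun y => if hy : x < y then h y hy else 0)
  refine ⟨(wellFounded_gt (α := P)).fix G, fun x => ?_⟩
  rw [WellFounded.fix_eq]
  simp [G]

section KLS

open Polynomial

variable {P : Type*} [PartialOrder P] [LocallyFiniteOrder P] {rk : P → ℕ} {κ : P → P → ℤ[X]}

/-- If `f` satisfies the KLS recursion above `x`, then the sum over the half-open interval
`(x, z]` is antisymmetric under reversal. -/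
theorem reflect_sum_Ioc_eq_neg (hrk : Monotone rk) (hκ_refl : ∀ x : P, κ x x = 1)
    (hκ_deg : ∀ x y : P, x ≤ y → (κ x y).natDegree ≤ rk y - rk x)
    (hκ_ker : ∀ x z : P, x < z →
      ∑ y ∈ Finset.Icc x z, reflect (rk y - rk x) (κ x y) * κ y z = 0)
    {x z : P} {f : P → ℤ[X]}
    (hf_deg : ∀ y ∈ Finset.Ioc x z, (f y).natDegree ≤ rk z - rk y)
    (hf : ∀ y ∈ Finset.Ioc x z,
      reflect (rk z - rk y) (f y) = ∑ w ∈ Finset.Icc y z, κ y w * f w) :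
    reflect (rk z - rk x) (∑ y ∈ Finset.Ioc x z, κ x y * f y) =
      -∑ y ∈ Finset.Ioc x z, κ x y * f y := by
  have hterm : ∀ y ∈ Finset.Ioc x z, reflect (rk z - rk x) (κ x y * f y) =
      ∑ w ∈ Finset.Icc y z, reflect (rk y - rk x) (κ x y) * κ y w * f w := by
    intro y hy
    have hy' := Finset.mem_Ioc.mp hy
    have h1 := hrk hy'.1.le
    have h2 := hrk hy'.2
    rw [show rk z - rk x = (rk y - rk x) + (rk z - rk y) by omega,
      reflect_mul _ _ (hκ_deg x y hy'.1.le) (hf_deg y hy), hf y hy, Finset.mul_sum]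
    simp only [mul_assoc]
  have hadd : ∀ s : Finset P, reflect (rk z - rk x) (∑ y ∈ s, κ x y * f y) =
      ∑ y ∈ s, reflect (rk z - rk x) (κ x y * f y) := by
    intro s
    ext i
    simp [coeff_reflect]
  rw [hadd, Finset.sum_congr rfl hterm,
    Finset.sum_comm' (t' := Finset.Ioc x z) (s' := fun w => Finset.Ioc x w),
    ← Finset.sum_neg_distrib]
  · refine Finset.sum_congr rfl fun w hw => ?_
    have hw' := (Finset.mem_Ioc.mp hw).1
    have hker := hκ_ker x w hw'
    rw [← Finset.sum_Ioc_add_eq_sum_Icc hw'.le] at hker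
    simp only [Nat.sub_self, hκ_refl, reflect_one, pow_zero, one_mul] at hker
    rw [← Finset.sum_mul, eq_neg_of_add_eq_zero_left hker, neg_mul]
  · intro y w
    simp only [Finset.mem_Ioc, Finset.mem_Icc]
    constructor
    · rintro ⟨⟨h1, h2⟩, h3, h4⟩
      exact ⟨⟨h1, h3⟩, h1.trans_le h3, h4⟩
    · rintro ⟨⟨h1, h3⟩, h2, h4⟩
      exact ⟨⟨h1, h3.trans h4⟩, h3, h4⟩

/-- For a fixed upper end point `z`, the right KLS polynomials exist. -/
theorem exists_right_KLS_polynomials_of_top [WellFoundedGT P] (hrk : Monotone rk)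
    (hκ_refl : ∀ x : P, κ x x = 1)
    (hκ_deg : ∀ x y : P, x ≤ y → (κ x y).natDegree ≤ rk y - rk x)
    (hκ_ker : ∀ x z : P, x < z →
      ∑ y ∈ Finset.Icc x z, reflect (rk y - rk x) (κ x y) * κ y z = 0) (z : P) :
    ∃ f : P → ℤ[X], f z = 1 ∧
      (∀ x < z, ∀ i, rk z - rk x ≤ 2 * i → (f x).coeff i = 0) ∧
      ∀ x < z, reflect (rk z - rk x) (f x) = ∑ y ∈ Finset.Icc x z, κ x y * f y := by
  classical
  obtain ⟨f, hf⟩ := WellFoundedGT.exists_eq_of_restrict (P := P) (M := ℤ[X]) fun x h =>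
    if x = z then 1 else negLowerHalf (rk z - rk x) (∑ y ∈ Finset.Ioc x z, κ x y * h y)
  have hz : f z = 1 := by rw [hf]; simp
  have hlt : ∀ x < z,
      f x = negLowerHalf (rk z - rk x) (∑ y ∈ Finset.Ioc x z, κ x y * f y) := by
    intro x hx
    rw [hf, if_neg hx.ne]
    congr 1
    refine Finset.sum_congr rfl fun y hy => ?_
    simp only [if_pos (Finset.mem_Ioc.mp hy).1]
  have hdeg : ∀ x < z, ∀ i, rk z - rk x ≤ 2 * i → (f x).coeff i = 0 := by
    intro x hx i hi
    rw [hlt x hx, coeff_negLowerHalf, if_neg (by omega)]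
  have hnat : ∀ x ≤ z, (f x).natDegree ≤ rk z - rk x := by
    intro x hx
    rcases hx.eq_or_lt with rfl | hx
    · simp [hz]
    · exact natDegree_le_iff_coeff_eq_zero.mpr fun i hi => hdeg x hx i (by omega)
  refine ⟨f, hz, hdeg, fun x => ?_⟩
  induction x using WellFoundedGT.induction with
  | ind x ih =>
  intro hx
  rw [← Finset.sum_Ioc_add_eq_sum_Icc hx.le, hκ_refl, one_mul]
  have hsum : (∑ y ∈ Finset.Ioc x z, κ x y * f y).natDegree ≤ rk z - rk x := by
    refine natDegree_sum_le_of_forall_le _ _ fun y hy => ?_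
    have hy := Finset.mem_Ioc.mp hy
    have h1 := hrk hy.1.le
    have h2 := hrk hy.2
    exact (natDegree_mul_le_of_le (hκ_deg x y hy.1.le) (hnat y hy.2)).trans (by omega)
  have hanti := reflect_sum_Ioc_eq_neg (x := x) (z := z) (f := f) hrk hκ_refl hκ_deg hκ_ker
    (fun y hy => hnat y (Finset.mem_Ioc.mp hy).2) fun y hy => by
      obtain ⟨hxy, hyz⟩ := Finset.mem_Ioc.mp hy
      rcases hyz.eq_or_lt with rfl | hyz
      · simp [hz, hκ_refl]
      · exact ih y hxy hyz
  have := reflect_negLowerHalf hsum hanti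
  rw [← hlt x hx] at this
  rw [this, add_comm]

/-- For a fixed upper end point `z`, the right KLS polynomials are unique. -/
theorem right_KLS_polynomials_unique [WellFoundedGT P]
    (hκ_refl : ∀ x : P, κ x x = 1) {z : P} {f g : P → ℤ[X]} (hfg : f z = g z)
    (hf_deg : ∀ x < z, ∀ i, rk z - rk x ≤ 2 * i → (f x).coeff i = 0)
    (hg_deg : ∀ x < z, ∀ i, rk z - rk x ≤ 2 * i → (g x).coeff i = 0)
    (hf : ∀ x < z, reflect (rk z - rk x) (f x) = ∑ y ∈ Finset.Icc x z, κ x y * f y)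
    (hg : ∀ x < z, reflect (rk z - rk x) (g x) = ∑ y ∈ Finset.Icc x z, κ x y * g y) :
    ∀ x ≤ z, f x = g x := by
  intro x
  induction x using WellFoundedGT.induction with
  | ind x ih =>
  intro hx
  rcases hx.eq_or_lt with rfl | hx
  · exact hfg
  refine eq_of_reflect_sub_eq (hf_deg x hx) (hg_deg x hx) ?_
  rw [hf x hx, hg x hx, ← Finset.sum_Ioc_add_eq_sum_Icc hx.le,
    ← Finset.sum_Ioc_add_eq_sum_Icc hx.le, hκ_refl, one_mul, one_mul, add_sub_cancel_right,
    add_sub_cancel_right]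
  refine Finset.sum_congr rfl fun y hy => ?_
  rw [ih y (Finset.mem_Ioc.mp hy).1 (Finset.mem_Ioc.mp hy).2]

end KLS


/-- Let `P` be a finite bounded graded poset and `κ` a `P`-kernel.
There exists a unique family `f = (f_{xy})_{x ≤ y}` of polynomials in `ℤ[t]`
(the right Kazhdan–Lusztig–Stanley polynomials of `κ`) such that:
(i) `f_{xx} = 1`; (ii) `deg f_{xy} < rk[x,y]/2` for `x < y`; and
(iii) `t^{rk[x,z]} f_{xz}(1/t) = ∑_{x ≤ y ≤ z} κ_{xy}(t) f_{yz}(t)` for `x < z`,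
where `t^d f(1/t)` is the `d`-reversal `Polynomial.reflect d f`. -/
theorem exists_unique_right_KLS_polynomials
    {P : Type*} [PartialOrder P] [BoundedOrder P] [Fintype P] [LocallyFiniteOrder P]
    (rk : P → ℕ) (hrk_bot : rk ⊥ = 0)
    (hrk_cov : ∀ x y : P, x ⋖ y → rk y = rk x + 1)
    (κ : P → P → Polynomial ℤ)
    (hκ_refl : ∀ x : P, κ x x = 1)
    (hκ_deg : ∀ x y : P, x ≤ y → (κ x y).natDegree ≤ rk y - rk x)
    (hκ_ker : ∀ x z : P, x < z →
      ∑ y ∈ Finset.Icc x z, Polynomial.reflect (rk y - rk x) (κ x y) * κ y z = 0) :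
    ∃ f : P → P → Polynomial ℤ,
      ((∀ x : P, f x x = 1) ∧
        (∀ x y : P, x < y →
          2 * (f x y).degree < ((rk y - rk x : ℕ) : WithBot ℕ)) ∧
        (∀ x z : P, x < z →
          Polynomial.reflect (rk z - rk x) (f x z)
            = ∑ y ∈ Finset.Icc x z, κ x y * f y z)) ∧
      ∀ g : P → P → Polynomial ℤ,
        ((∀ x : P, g x x = 1) ∧
          (∀ x y : P, x < y →
            2 * (g x y).degree < ((rk y - rk x : ℕ) : WithBot ℕ)) ∧
          (∀ x z : P, x < z →
            Polynomial.reflect (rk z - rk x) (g x z)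
              = ∑ y ∈ Finset.Icc x z, κ x y * g y z)) →
        ∀ x y : P, x ≤ y → g x y = f x y := by
  have hrk : Monotone rk :=
    (strictMono_iff_forall_covBy rk |>.mpr fun x y h => by have := hrk_cov x y h; omega).monotone
  choose F hF_refl hF_deg hF using
    exists_right_KLS_polynomials_of_top hrk hκ_refl hκ_deg hκ_ker
  refine ⟨fun x z => F z x, ⟨hF_refl, fun x z hxz => ?_, fun x z => hF z x⟩, ?_⟩
  · exact (Polynomial.two_mul_degree_lt_iff _ _).mpr (hF_deg z x hxz)
  · rintro g ⟨hg_refl, hg_deg, hg⟩ x z hxz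
    exact right_KLS_polynomials_unique (f := fun x => g x z) (g := F z) hκ_refl
      ((hg_refl z).trans (hF_refl z).symm)
      (fun x hx => (Polynomial.two_mul_degree_lt_iff _ _).mp (hg_deg x z hx)) (hF_deg z)
      (fun x hx => hg x z hx) (hF z) x hxz
end

section
/- Let P be a finite bounded graded poset and let κ be a P-kernel. Then the family κ̄ defined by κ̄_{xy}(t) := t^{rk[x,y]}·κ_{xy}(1/t) is also a P-kernel; in particular κ̄_{xx} = 1 for all x, deg κ̄_{xy} ≤ rk[x,y] for all x ≤ y, and for all x < z one has Σ_{x≤y≤z} κ_{xy}(t)·κ̄_{yz}(t) = 0 in ℤ[t]. -/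
/-- Reflection commutes with finite sums. -/
lemma Polynomial.reflect_finset_sum {R ι : Type*} [Semiring R] (N : ℕ) (s : Finset ι)
    (f : ι → Polynomial R) :
    Polynomial.reflect N (∑ i ∈ s, f i) = ∑ i ∈ s, Polynomial.reflect N (f i) := by
  classical
  induction s using Finset.induction_on with
  | empty => simp
  | insert a s ha ih => rw [Finset.sum_insert ha, Finset.sum_insert ha, reflect_add, ih]

/-- Let `P` be a finite bounded graded poset and `κ` a `P`-kernel.
Then the family `κ̄` defined by `κ̄_{xy}(t) = t^{rk[x,y]} κ_{xy}(1/t)`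
(the `rk[x,y]`-reversal `Polynomial.reflect (rk[x,y]) (κ x y)`) is also a `P`-kernel:
(i) `κ̄_{xx} = 1`; (ii) `deg κ̄_{xy} ≤ rk[x,y]`; and (iii) for all `x < z`,
`∑_{x ≤ y ≤ z} κ_{xy}(t) κ̄_{yz}(t) = 0` in `ℤ[t]`. -/
theorem inverse_kernel_is_P_kernel
    {P : Type*} [PartialOrder P] [BoundedOrder P] [Fintype P] [LocallyFiniteOrder P]
    (rk : P → ℕ) (hrk_bot : rk ⊥ = 0)
    (hrk_cov : ∀ x y : P, x ⋖ y → rk y = rk x + 1)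
    (κ : P → P → Polynomial ℤ)
    (hκ_refl : ∀ x : P, κ x x = 1)
    (hκ_deg : ∀ x y : P, x ≤ y → (κ x y).natDegree ≤ rk y - rk x)
    (hκ_ker : ∀ x z : P, x < z →
      ∑ y ∈ Finset.Icc x z, Polynomial.reflect (rk y - rk x) (κ x y) * κ y z = 0) :
    (∀ x : P, Polynomial.reflect (rk x - rk x) (κ x x) = 1) ∧
    (∀ x y : P, x ≤ y →
      (Polynomial.reflect (rk y - rk x) (κ x y)).natDegree ≤ rk y - rk x) ∧
    (∀ x z : P, x < z →
      ∑ y ∈ Finset.Icc x z, κ x y * Polynomial.reflect (rk z - rk y) (κ y z) = 0) := by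
  have rk_mono : Monotone rk :=
    (monotone_iff_forall_covBy rk).2 fun x y h => by have := hrk_cov x y h; omega
  have deg_reflect : ∀ x y : P, x ≤ y →
      (Polynomial.reflect (rk y - rk x) (κ x y)).natDegree ≤ rk y - rk x := fun x y h =>
    Polynomial.natDegree_reflect_le.trans (max_le le_rfl (hκ_deg x y h))
  refine ⟨fun x => by simp [hκ_refl, Polynomial.reflect_one], deg_reflect, fun x z hxz => ?_⟩
  have h := congrArg (Polynomial.reflect (rk z - rk x)) (hκ_ker x z hxz)
  rw [Polynomial.reflect_finset_sum, Polynomial.reflect_zero] at h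
  rw [← h]
  refine Finset.sum_congr rfl fun y hy => ?_
  obtain ⟨hxy, hyz⟩ := Finset.mem_Icc.1 hy
  have hrk : rk z - rk x = (rk y - rk x) + (rk z - rk y) := by
    have := rk_mono hxy
    have := rk_mono hyz
    omega
  rw [hrk, Polynomial.reflect_mul _ _ (deg_reflect x y hxy) (hκ_deg y z hyz),
    Polynomial.reflect_reflect]
end

section
/- Let L be a finite geometric lattice. Then any two maximal chains of L are connected by a sequence of elementary exchanges: for all maximal chains C and C' of L there exist maximal chains C = C_0, C_1, …, C_m = C' such that for each i, the chain C_{i+1} is obtained from C_i by replacing exactly one element, i.e. C_{i+1} = (C_i \ {a}) ∪ {b} for some a ∈ C_i and b ∉ C_i. -/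
/-- `S` is a maximal chain of the principal filter of elements above `x`. -/
structure IsMaxChainAbove {L : Type*} [Preorder L] (x : L) (S : Set L) : Prop where
  isChain : IsChain (· ≤ ·) S
  le : ∀ s ∈ S, x ≤ s
  mem : ∀ p, x ≤ p → (∀ s ∈ S, p ≤ s ∨ s ≤ p) → p ∈ S

/-- `T` arises from `S` by exchanging exactly one element, both being maximal chains above `x`. -/
def ExchangeAbove {L : Type*} [Preorder L] (x : L) (S T : Set L) : Prop :=
  IsMaxChainAbove x S ∧ IsMaxChainAbove x T ∧ ∃ a ∈ S, ∃ b ∉ S, T = insert b (S \ {a})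

theorem isMaxChainAbove_bot_iff {L : Type*} [Preorder L] [OrderBot L] {S : Set L} :
    IsMaxChainAbove ⊥ S ↔ IsMaxChain (· ≤ ·) S := by
  constructor
  · intro h
    refine ⟨h.isChain, fun T hT hST => hST.antisymm fun p hp => h.mem p bot_le fun s hs => ?_⟩
    exact hT.total hp (hST hs)
  · intro h
    refine ⟨h.isChain, fun _ _ => bot_le, fun p _ hp => ?_⟩
    have hins : IsChain (· ≤ ·) (insert p S) := h.isChain.insert fun s hs _ => hp s hs
    rw [h.2 hins (Set.subset_insert p S)]
    exact Set.mem_insert p S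

namespace IsMaxChainAbove

theorem self_mem {L : Type*} [Preorder L] {x : L} {S : Set L} (h : IsMaxChainAbove x S) : x ∈ S :=
  h.mem x le_rfl fun s hs => Or.inl (h.le s hs)

theorem eq_singleton_top {L : Type*} [PartialOrder L] [OrderTop L] {S : Set L}
    (h : IsMaxChainAbove ⊤ S) : S = {⊤} :=
  Set.eq_singleton_iff_unique_mem.2 ⟨h.self_mem, fun s hs => top_le_iff.1 (h.le s hs)⟩

theorem insert_of_covBy {L : Type*} [PartialOrder L] {x y : L} {S : Set L} (hxy : x ⋖ y)
    (h : IsMaxChainAbove y S) : IsMaxChainAbove x (insert x S) := by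
  have hx : ∀ s ∈ S, x ≤ s := fun s hs => hxy.le.trans (h.le s hs)
  refine ⟨h.isChain.insert fun s hs _ => Or.inl (hx s hs), ?_, fun p hp hcomp => ?_⟩
  · rintro s (rfl | hs)
    exacts [le_rfl, hx s hs]
  · rcases hp.eq_or_lt with rfl | hlt
    · exact Set.mem_insert _ _
    · refine Set.mem_insert_of_mem _ (h.mem p ?_ fun s hs => hcomp s (Set.mem_insert_of_mem _ hs))
      rcases hcomp y (Set.mem_insert_of_mem _ h.self_mem) with hpy | hyp
      · exact (hpy.eq_of_not_lt (hxy.2 hlt)).ge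
      · exact hyp

theorem exists_eq_insert {L : Type*} [PartialOrder L] [OrderTop L] [Finite L] {x : L} {S : Set L}
    (h : IsMaxChainAbove x S) (hx : x ≠ ⊤) :
    ∃ y T, x ⋖ y ∧ IsMaxChainAbove y T ∧ S = insert x T := by
  have hne : (S \ {x}).Nonempty :=
    ⟨⊤, h.mem ⊤ le_top fun _ _ => Or.inr le_top, fun hx' => hx hx'.symm⟩
  obtain ⟨y, hy⟩ := (Set.toFinite (S \ {x})).exists_minimal hne
  have hyS : y ∈ S := hy.prop.1
  have hxy : x < y := lt_of_le_of_ne (h.le y hyS) fun e => hy.prop.2 e.symm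
  have hleast : ∀ s ∈ S, s ≠ x → y ≤ s := fun s hs hsx =>
    (h.isChain.total hyS hs).elim id fun hsy => hy.le_of_le ⟨hs, hsx⟩ hsy
  refine ⟨y, S \ {x}, ⟨hxy, fun p hxp hpy => ?_⟩,
    ⟨h.isChain.mono Set.sdiff_subset, fun s hs => hleast s hs.1 hs.2, fun p hyp hcomp => ?_⟩,
    by rw [Set.insert_sdiff_singleton, Set.insert_eq_of_mem h.self_mem]⟩
  · refine hpy.not_ge (hleast p (h.mem p hxp.le fun s hs => ?_) hxp.ne')
    by_cases hsx : s = x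
    · exact Or.inr (hsx ▸ hxp.le)
    · exact Or.inl (hpy.le.trans (hleast s hs hsx))
  · have hxp := hxy.trans_le hyp
    refine ⟨h.mem p hxp.le fun s hs => ?_, hxp.ne'⟩
    by_cases hsx : s = x
    · exact Or.inr (hsx ▸ hxp.le)
    · exact hcomp s ⟨hs, hsx⟩

end IsMaxChainAbove

theorem exists_isMaxChainAbove {L : Type*} [PartialOrder L] (x : L) :
    ∃ S, IsMaxChainAbove x S := by
  obtain ⟨M, hM⟩ : ∃ M : Set (Set.Ici x), IsMaxChainAbove ⊥ M :=
    ⟨_, isMaxChainAbove_bot_iff.2 maxChain_spec⟩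
  refine ⟨Subtype.val '' M, hM.isChain.image_of_map_rel _ _ Subtype.val fun _ _ h => h, ?_, fun p hp hcomp => ?_⟩
  · rintro _ ⟨s, -, rfl⟩
    exact s.2
  · exact ⟨⟨p, hp⟩, hM.mem _ bot_le fun s hs => hcomp s ⟨s, hs, rfl⟩, rfl⟩

theorem ExchangeAbove.insert_of_covBy {L : Type*} [PartialOrder L] {x y : L} {S T : Set L}
    (hxy : x ⋖ y) (h : ExchangeAbove y S T) : ExchangeAbove x (insert x S) (insert x T) := by
  obtain ⟨hS, hT, a, ha, b, hb, rfl⟩ := h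
  have hxa : x ≠ a := (hxy.lt.trans_le (hS.le a ha)).ne
  have hxb : x ≠ b := (hxy.lt.trans_le (hT.le b (Set.mem_insert _ _))).ne
  refine ⟨hS.insert_of_covBy hxy, hT.insert_of_covBy hxy, a, Set.mem_insert_of_mem _ ha, b, ?_, ?_⟩
  · rintro (e | hbS)
    exacts [hxb e.symm, hb hbS]
  · rw [Set.insert_sdiff_of_notMem _ (by simpa using hxa), Set.insert_comm]

theorem reflTransGen_exchangeAbove {L : Type*} [Lattice L] [OrderTop L] [Finite L]
    [IsWeakUpperModularLattice L] (x : L) {S T : Set L}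
    (hS : IsMaxChainAbove x S) (hT : IsMaxChainAbove x T) :
    Relation.ReflTransGen (ExchangeAbove x) S T := by
  induction x using WellFoundedGT.induction generalizing S T with
  | ind x ih =>
    by_cases hx : x = ⊤
    · subst hx
      rw [hS.eq_singleton_top, hT.eq_singleton_top]
    obtain ⟨y, S', hxy, hS', rfl⟩ := hS.exists_eq_insert hx
    obtain ⟨z, T', hxz, hT', rfl⟩ := hT.exists_eq_insert hx
    have lift {y : L} (hxy : x ⋖ y) {A B : Set L} (hA : IsMaxChainAbove y A)
        (hB : IsMaxChainAbove y B) :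
        Relation.ReflTransGen (ExchangeAbove x) (insert x A) (insert x B) :=
      (ih y hxy.lt hA hB).lift _ fun _ _ h => h.insert_of_covBy hxy
    by_cases hyz : y = z
    · subst hyz
      exact lift hxy hS' hT'
    have hinf : y ⊓ z = x := by
      refine ((hxy.eq_or_eq (le_inf hxy.le hxz.le) inf_le_left).resolve_right fun e => hyz ?_)
      exact (hxz.eq_or_eq hxy.le (inf_eq_left.1 e)).resolve_left hxy.lt.ne'
    have hy : y ⋖ y ⊔ z := covBy_sup_of_inf_covBy_of_inf_covBy_left (hinf ▸ hxy) (hinf ▸ hxz)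
    have hz : z ⋖ y ⊔ z := covBy_sup_of_inf_covBy_of_inf_covBy_right (hinf ▸ hxy) (hinf ▸ hxz)
    obtain ⟨U, hU⟩ := exists_isMaxChainAbove (y ⊔ z)
    have hyU := hU.insert_of_covBy hy
    have hzU := hU.insert_of_covBy hz
    have hexch : ExchangeAbove x (insert x (insert y U)) (insert x (insert z U)) := by
      refine ⟨hyU.insert_of_covBy hxy, hzU.insert_of_covBy hxz, y, by simp, z, ?_, ?_⟩
      · rintro (e | e | hzU')
        exacts [hxz.lt.ne' e, hyz e.symm, hz.lt.not_ge (hU.le z hzU')]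
      · have hyU' : y ∉ U := fun h => hy.lt.not_ge (hU.le y h)
        rw [Set.insert_sdiff_of_notMem _ (by simpa using hxy.lt.ne),
          Set.insert_sdiff_self_of_notMem hyU', Set.insert_comm]
    exact ((lift hxy hS' hyU).tail hexch).trans (lift hxz hzU hT')

theorem Relation.ReflTransGen.exists_sequence {α : Type*} {r : α → α → Prop} {a b : α}
    (h : Relation.ReflTransGen r a b) :
    ∃ (m : ℕ) (f : ℕ → α), f 0 = a ∧ f m = b ∧ ∀ i < m, r (f i) (f (i + 1)) := by
  induction h using Relation.ReflTransGen.head_induction_on with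
  | refl => exact ⟨0, fun _ => b, rfl, rfl, by simp⟩
  | @head a c hac _ ih =>
    obtain ⟨m, f, rfl, hm, hf⟩ := ih
    refine ⟨m + 1, fun | 0 => a | n + 1 => f n, rfl, hm, fun i hi => ?_⟩
    cases i with
    | zero => exact hac
    | succ i => exact hf i (by omega)


/-- Let `L` be a finite geometric lattice (a finite lattice which is
atomistic and upper semimodular).  Then any two maximal chains of `L` are connected by a
sequence of elementary exchanges: for all maximal chains `C`, `C'` there exist maximal
chains `C = D 0, D 1, …, D m = C'` such that each `D (i+1)` is obtained from `D i` by
replacing exactly one element, i.e. `D (i+1) = (D i \ {a}) ∪ {b}` for some `a ∈ D i` and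
`b ∉ D i`. -/
theorem geometric_lattice_maximal_chains_connected_by_exchanges
    {L : Type*} [Lattice L] [BoundedOrder L] [Fintype L]
    (hAtomistic : ∀ x : L, ∃ s : Finset L, (∀ a ∈ s, IsAtom a) ∧ x = s.sup id)
    (hUpperSemimodular : ∀ a b : L, a ⊓ b ⋖ b → a ⋖ a ⊔ b)
    (C C' : Set L) (hC : IsMaxChain (· ≤ ·) C) (hC' : IsMaxChain (· ≤ ·) C') :
    ∃ (m : ℕ) (D : ℕ → Set L),
      D 0 = C ∧ D m = C' ∧
      (∀ i ≤ m, IsMaxChain (· ≤ ·) (D i)) ∧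
      (∀ i < m, ∃ a ∈ D i, ∃ b ∉ D i, D (i + 1) = insert b (D i \ {a})) := by
  have : IsWeakUpperModularLattice L :=
    ⟨fun {a b} _ hb => hUpperSemimodular a b hb⟩
  obtain ⟨m, D, h0, hm, hD⟩ := (reflTransGen_exchangeAbove ⊥ (isMaxChainAbove_bot_iff.2 hC)
    (isMaxChainAbove_bot_iff.2 hC')).exists_sequence
  refine ⟨m, D, h0, hm, fun i hi => ?_, fun i hi => (hD i hi).2.2⟩
  rcases hi.eq_or_lt with rfl | hlt
  · exact hm ▸ hC'
  · exact isMaxChainAbove_bot_iff.1 (hD i hlt).1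
end

section
/- Let P be a finite bounded graded poset with the following atom-connectivity property: for every interval [x,y] of P with rk[x,y] ≥ 2 and every pair of atoms a, a' of [x,y], there exists a finite sequence of atoms a = a_0, a_1, …, a_k = a' of [x,y] such that for each j < k there is an element b with a_j ≤ b, a_{j+1} ≤ b, b ≤ y and rk[x,b] = 2. Then any two maximal chains of P are connected by a sequence of elementary exchanges: for all maximal chains C and C' of P there exist maximal chains C = C_0, C_1, …, C_m = C' such that for each i the chain C_{i+1} is obtained from C_i by replacing exactly one element, i.e. C_{i+1} = (C_i \ {a}) ∪ {b} for some a ∈ C_i and b ∉ C_i. -/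
/-- `D'` arises from `D` by an elementary exchange, and `D'` is again a maximal chain. -/
def ChainExchange {P : Type*} [PartialOrder P] (D D' : Set P) : Prop :=
  IsMaxChain (· ≤ ·) D' ∧ ∃ a ∈ D, ∃ b ∉ D, D' = insert b (D \ {a})

section

variable {P : Type*} [PartialOrder P]

theorem IsMaxChain.le_total {C : Set P} (hC : IsMaxChain (· ≤ ·) C) {x y : P} (hx : x ∈ C)
    (hy : y ∈ C) : x ≤ y ∨ y ≤ x :=
  hC.1.total hx hy

theorem IsMaxChain.mem_of_comparable {C : Set P} (hC : IsMaxChain (· ≤ ·) C) {z : P}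
    (hz : ∀ c ∈ C, z ≤ c ∨ c ≤ z) : z ∈ C := by
  have h := hC.2 (hC.1.insert fun c hc _ => hz c hc) (Set.subset_insert z C)
  rw [h]
  exact Set.mem_insert z C

theorem isMaxChain_of_comparable {C : Set P} (hC : IsChain (· ≤ ·) C)
    (h : ∀ z, (∀ c ∈ C, z ≤ c ∨ c ≤ z) → z ∈ C) : IsMaxChain (· ≤ ·) C :=
  ⟨hC, fun _ ht hCt => hCt.antisymm fun z hz => h z fun _ hc => ht.total hz (hCt hc)⟩

/-- The part of a maximal chain below one of its elements `x`, together with a chain above `x`,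
extends to a maximal chain with the same part below `x`. -/
theorem IsMaxChain.exists_extension {C T : Set P} (hC : IsMaxChain (· ≤ ·) C) {x : P}
    (hx : x ∈ C) (hT : IsChain (· ≤ ·) T) (hxT : ∀ t ∈ T, x ≤ t) :
    ∃ E, IsMaxChain (· ≤ ·) E ∧ T ⊆ E ∧ ∀ z ≤ x, (z ∈ C ↔ z ∈ E) := by
  have hchain : IsChain (· ≤ ·) (C ∩ Set.Iic x ∪ T) := by
    rintro u (⟨hu, hux⟩ | hu) v (⟨hv, hvx⟩ | hv) huv
    · exact hC.1 hu hv huv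
    · exact Or.inl (le_trans hux (hxT v hv))
    · exact Or.inr (le_trans hvx (hxT u hu))
    · exact hT hu hv huv
  obtain ⟨E, hE, hsub⟩ := hchain.exists_maxChain
  refine ⟨E, hE, fun t ht => hsub (Or.inr ht), fun z hz => ⟨fun h => hsub (Or.inl ⟨h, hz⟩), ?_⟩⟩
  intro h
  refine hC.mem_of_comparable fun c hc => ?_
  rcases hC.le_total hc hx with hcx | hxc
  · exact hE.le_total h (hsub (Or.inl ⟨hc, hcx⟩))
  · exact Or.inl (hz.trans hxc)

theorem IsMaxChain.exists_covBy_mem [Finite P] {C : Set P} (hC : IsMaxChain (· ≤ ·) C) {x y : P}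
    (hx : x ∈ C) (hy : y ∈ C) (hxy : x < y) : ∃ a ∈ C, x ⋖ a := by
  obtain ⟨a, ⟨haC, hxa⟩, hmin⟩ :=
    (Set.toFinite {z | z ∈ C ∧ x < z}).exists_minimal ⟨y, hy, hxy⟩
  refine ⟨a, haC, hxa, fun z hxz hza => ?_⟩
  have hz : z ∈ C := by
    refine hC.mem_of_comparable fun c hc => ?_
    rcases hC.le_total hc hx with hcx | hxc
    · exact Or.inr (hcx.trans hxz.le)
    rcases hxc.eq_or_lt with rfl | hxc
    · exact Or.inr hxz.le
    rcases hC.le_total hc haC with hca | hac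
    · exact Or.inl (hza.le.trans (hmin ⟨hc, hxc⟩ hca))
    · exact Or.inl (hza.le.trans hac)
  exact hza.not_ge (hmin ⟨hz, hxz⟩ hza.le)

theorem IsMaxChain.mem_iff_mem_of_le_of_covBy {C E : Set P} (hC : IsMaxChain (· ≤ ·) C)
    (hE : IsMaxChain (· ≤ ·) E) {x a : P} (hx : x ∈ C) (hCE : ∀ z ≤ x, (z ∈ C ↔ z ∈ E))
    (hxa : x ⋖ a) (haC : a ∈ C) (haE : a ∈ E) : ∀ z ≤ a, (z ∈ C ↔ z ∈ E) := by
  intro z hza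
  by_cases hzx : z ≤ x
  · exact hCE z hzx
  have hz (hxz : x ≤ z) : z = a :=
    (hxa.eq_or_eq hxz hza).resolve_left fun h => hzx h.le
  constructor
  · intro h
    rwa [hz ((hC.le_total h hx).resolve_left hzx)]
  · intro h
    rwa [hz ((hE.le_total h ((hCE x le_rfl).1 hx)).resolve_left hzx)]

/-- In a maximal chain through `x ⋖ p ⋖ b`, the element `p` may be replaced by any other
`q` with `x ⋖ q ⋖ b`. -/
theorem IsMaxChain.exchange {E : Set P} (hE : IsMaxChain (· ≤ ·) E) {x p q b : P}
    (hx : x ∈ E) (hp : p ∈ E) (hb : b ∈ E) (hxp : x ⋖ p) (hpb : p ⋖ b) (hxq : x ⋖ q)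
    (hqb : q ⋖ b) (hpq : p ≠ q) : ChainExchange E (insert q (E \ {p})) := by
  have hsplit : ∀ z ∈ E, z ≠ p → z ≤ x ∨ b ≤ z := by
    intro z hz hzp
    rcases hE.le_total hz hp with h | h
    · left
      rcases hE.le_total hz hx with h' | h'
      · exact h'
      · exact ((hxp.eq_or_eq h' h).resolve_right hzp).le
    · right
      rcases hE.le_total hz hb with h' | h'
      · exact ((hpb.eq_or_eq h h').resolve_left hzp).ge
      · exact h'
  have hqE : q ∉ E := by
    intro hq
    rcases hsplit q hq hpq.symm with h | h
    · exact hxq.lt.not_ge h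
    · exact hqb.lt.not_ge h
  refine ⟨isMaxChain_of_comparable ?_ ?_, p, hp, q, hqE, rfl⟩
  · refine (hE.1.mono Set.sdiff_subset).insert fun z hz _ => ?_
    rcases hsplit z hz.1 hz.2 with h | h
    · exact Or.inr (h.trans hxq.le)
    · exact Or.inl (hqb.le.trans h)
  · intro z hz
    have hmem : ∀ c ∈ E, c ≠ p → z ≤ c ∨ c ≤ z := fun c hc hcp => hz c (Or.inr ⟨hc, hcp⟩)
    have hof (hzp : z ≠ p) (h : z ≤ p ∨ p ≤ z) : z ∈ insert q (E \ {p}) := by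
      refine Or.inr ⟨hE.mem_of_comparable fun c hc => ?_, hzp⟩
      by_cases hcp : c = p
      · rwa [hcp]
      · exact hmem c hc hcp
    rcases hmem x hx hxp.lt.ne with h | hxz
    · exact hof (h.trans_lt hxp.lt).ne (Or.inl (h.trans hxp.le))
    rcases (hmem b hb hpb.lt.ne').symm with h | hzb
    · exact hof (hpb.lt.trans_le h).ne' (Or.inr (hpb.le.trans h))
    rcases hz q (Or.inl rfl) with hzq | hqz
    · rcases hxq.eq_or_eq hxz hzq with h | h
      · exact hof (h ▸ hxp.lt.ne) (Or.inl (h ▸ hxp.le))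
      · exact Or.inl h
    · rcases hqb.eq_or_eq hqz hzb with h | h
      · exact Or.inl h
      · exact hof (h ▸ hpb.lt.ne') (Or.inr (h ▸ hpb.le))

theorem strictMono_of_covBy_add_one [Finite P] {rk : P → ℕ}
    (hrk_cov : ∀ x y : P, x ⋖ y → rk y = rk x + 1) : StrictMono rk := by
  have := Fintype.ofFinite P
  classical
  let _ : LocallyFiniteOrder P := Fintype.toLocallyFiniteOrder
  intro x y hxy
  induction transGen_covBy_of_lt hxy with
  | single h => have := hrk_cov _ _ h; omega
  | tail hab h ih =>
    have := hrk_cov _ _ h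
    have := ih (lt_iff_transGen_covBy.2 hab)
    omega

/-- Two maximal chains which agree below a common element `x` are connected by exchanges. -/
theorem IsMaxChain.reflTransGen_chainExchange [BoundedOrder P] [Finite P] {rk : P → ℕ}
    (hrk_cov : ∀ x y : P, x ⋖ y → rk y = rk x + 1)
    (hAtomConn : ∀ x y : P, x ≤ y → 2 ≤ rk y - rk x →
      ∀ a a' : P, x ⋖ a → a ≤ y → x ⋖ a' → a' ≤ y →
        ∃ (k : ℕ) (c : ℕ → P), c 0 = a ∧ c k = a' ∧
          (∀ j ≤ k, x ⋖ c j ∧ c j ≤ y) ∧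
          (∀ j < k, ∃ b : P, c j ≤ b ∧ c (j + 1) ≤ b ∧ b ≤ y ∧ rk b - rk x = 2))
    (x : P) {C C' : Set P} (hC : IsMaxChain (· ≤ ·) C) (hC' : IsMaxChain (· ≤ ·) C')
    (hx : x ∈ C) (hCC' : ∀ z ≤ x, (z ∈ C ↔ z ∈ C')) :
    Relation.ReflTransGen ChainExchange C C' := by
  have hmono := strictMono_of_covBy_add_one hrk_cov
  induction x using WellFoundedGT.induction generalizing C C' with
  | ind x ih =>
  rcases (le_top : x ≤ ⊤).eq_or_lt with rfl | hxt
  · rw [show C = C' from Set.ext fun z => hCC' z le_top]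
  have hx' : x ∈ C' := (hCC' x le_rfl).1 hx
  obtain ⟨a, haC, hxa⟩ := hC.exists_covBy_mem hx hC.top_mem hxt
  obtain ⟨a', haC', hxa'⟩ := hC'.exists_covBy_mem hx' hC'.top_mem hxt
  have hstep {E E' : Set P} {p : P} (hE : IsMaxChain (· ≤ ·) E) (hE' : IsMaxChain (· ≤ ·) E')
      (hxE : x ∈ E) (hEE' : ∀ z ≤ x, (z ∈ E ↔ z ∈ E')) (hxp : x ⋖ p) (hpE : p ∈ E)
      (hpE' : p ∈ E') : Relation.ReflTransGen ChainExchange E E' :=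
    ih p hxp.lt hE hE' hpE (hE.mem_iff_mem_of_le_of_covBy hE' hxE hEE' hxp hpE hpE')
  by_cases hrk : 2 ≤ rk ⊤ - rk x
  swap
  · have htop {p : P} (hxp : x ⋖ p) : p = ⊤ := by
      by_contra hp
      have := hmono (lt_top_iff_ne_top.2 hp)
      have := hrk_cov _ _ hxp
      omega
    exact hstep hC hC' hx hCC' hxa haC (by rwa [htop hxa, ← htop hxa'])
  obtain ⟨k, c, hc0, hck, hc, hcb⟩ :=
    hAtomConn x ⊤ le_top hrk a a' hxa le_top hxa' le_top
  have key : ∀ j ≤ k, ∀ E, IsMaxChain (· ≤ ·) E → (∀ z ≤ x, (z ∈ C ↔ z ∈ E)) → c j ∈ E →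
      Relation.ReflTransGen ChainExchange C E := by
    intro j
    induction j with
    | zero =>
      intro _ E hE hCE hcE
      exact hstep hC hE hx hCE hxa haC (hc0 ▸ hcE)
    | succ j ihj =>
      intro hj E hE hCE hcE
      obtain ⟨b, hpb, hqb, -, hrb⟩ := hcb j hj
      have hxp := (hc j (by omega)).1
      have hxq := (hc (j + 1) hj).1
      have hcov {p : P} (hxp : x ⋖ p) (hpb : p ≤ b) : p ⋖ b := by
        have hp := hrk_cov _ _ hxp
        refine ⟨hpb.lt_of_ne fun h => ?_, fun z hpz hzb => ?_⟩
        · subst h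
          omega
        · have := hmono hpz
          have := hmono hzb
          omega
      obtain ⟨F, hF, hTF, hCF⟩ := hC.exists_extension (T := {c j, b}) hx
        (IsChain.pair hpb) (by
          rintro t (rfl | rfl)
          · exact hxp.le
          · exact hxp.le.trans hpb)
      have hpF : c j ∈ F := hTF (Or.inl rfl)
      have hbF : b ∈ F := hTF (Or.inr rfl)
      have hxF := (hCF x le_rfl).1 hx
      have hCF' := ihj (by omega) F hF hCF hpF
      have hFE : ∀ z ≤ x, (z ∈ F ↔ z ∈ E) := fun z hz => (hCF z hz).symm.trans (hCE z hz)
      by_cases hpq : c j = c (j + 1)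
      · exact hCF'.trans (hstep hF hE hxF hFE hxq (hpq ▸ hpF) hcE)
      have hex := hF.exchange hxF hpF hbF hxp (hcov hxp hpb) hxq (hcov hxq hqb) hpq
      have hiff : ∀ z ≤ x, (z ∈ insert (c (j + 1)) (F \ {c j}) ↔ z ∈ F) := by
        intro z hz
        have hzp : z ≠ c j := (hz.trans_lt hxp.lt).ne
        have hzq : z ≠ c (j + 1) := (hz.trans_lt hxq.lt).ne
        simp [hzp, hzq]
      exact (hCF'.tail hex).trans (hstep hex.1 hE ((hiff x le_rfl).2 hxF)
        (fun z hz => (hiff z hz).trans (hFE z hz)) hxq (Or.inl rfl) hcE)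
  exact key k le_rfl C' hC' hCC' (hck ▸ haC')

end


/-- Let `P` be a finite bounded graded poset with the atom-connectivity
property: for every interval `[x,y]` with `rk[x,y] ≥ 2` and every pair of atoms `a`, `a'`
of `[x,y]` (elements of `[x,y]` covering `x`), there is a sequence of atoms
`a = c 0, c 1, …, c k = a'` of `[x,y]` such that consecutive atoms `c j`, `c (j+1)` lie
below a common element `b ≤ y` with `rk[x,b] = 2`.  Then any two maximal chains of `P`
are connected by a sequence of elementary exchanges. -/
theorem graded_poset_maximal_chains_connected_by_exchanges
    {P : Type*} [PartialOrder P] [BoundedOrder P] [Fintype P]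
    (rk : P → ℕ) (hrk_bot : rk ⊥ = 0)
    (hrk_cov : ∀ x y : P, x ⋖ y → rk y = rk x + 1)
    (hAtomConn : ∀ x y : P, x ≤ y → 2 ≤ rk y - rk x →
      ∀ a a' : P, x ⋖ a → a ≤ y → x ⋖ a' → a' ≤ y →
        ∃ (k : ℕ) (c : ℕ → P), c 0 = a ∧ c k = a' ∧
          (∀ j ≤ k, x ⋖ c j ∧ c j ≤ y) ∧
          (∀ j < k, ∃ b : P, c j ≤ b ∧ c (j + 1) ≤ b ∧ b ≤ y ∧ rk b - rk x = 2))
    (C C' : Set P) (hC : IsMaxChain (· ≤ ·) C) (hC' : IsMaxChain (· ≤ ·) C') :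
    ∃ (m : ℕ) (D : ℕ → Set P),
      D 0 = C ∧ D m = C' ∧
      (∀ i ≤ m, IsMaxChain (· ≤ ·) (D i)) ∧
      (∀ i < m, ∃ a ∈ D i, ∃ b ∉ D i, D (i + 1) = insert b (D i \ {a})) := by
  have h : Relation.ReflTransGen ChainExchange C C' := by
    refine hC.reflTransGen_chainExchange hrk_cov hAtomConn ⊥ hC' hC.bot_mem fun z hz => ?_
    rw [le_bot_iff.1 hz]
    exact iff_of_true hC.bot_mem hC'.bot_mem
  induction h using Relation.ReflTransGen.head_induction_on with
  | refl => exact ⟨0, fun _ => C', rfl, rfl, fun _ _ => hC', fun _ h => absurd h (Nat.not_lt_zero _)⟩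
  | @head C E hCE _ ih =>
    obtain ⟨m, D, hD0, hDm, hD, hDstep⟩ := ih hCE.1
    refine ⟨m + 1, fun i => Nat.casesOn i C D, rfl, hDm, ?_, ?_⟩
    · rintro (_ | i) hi
      · exact hC
      · exact hD i (Nat.le_of_succ_le_succ hi)
    · rintro (_ | i) hi
      · obtain ⟨a, ha, b, hb, hE⟩ := hCE.2
        exact ⟨a, ha, b, hb, hD0.trans hE⟩
      · exact hDstep i (Nat.lt_of_succ_lt_succ hi)
end
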